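/- For any two faces F, G of 𝒜, the face G covers F in the facial weak order FW(𝒜,B) if and only if |dim F − dim G| = 1 and either (F ⊆ G and M_F = M_G) or (G ⊆ F and m_F = m_G). -/

import Mathlib

open scoped RealInnerProductSpace Pointwise

variable {V : Type*} [NormedAddCommGroup V] [InnerProductSpace ℝ V] [FiniteDimensional ℝ V]
  {ι : Type*} [Fintype ι]

/-- The (open) complement of the union of the hyperplanes with chosen normals `e i`. -/
def arrComplement (e : ι → V) : Set V := {v | ∀ i, ⟪e i, v⟫ ≠ 0}

/-- A region of the arrangement: the closure of a connected component of the complement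
of the union of the hyperplanes. -/
def IsRegion (e : ι → V) (R : Set V) : Prop :=
  ∃ x ∈ arrComplement e, R = closure (connectedComponentIn (arrComplement e) x)

/-- The positive closed half-space bounded by the hyperplane with normal `e i`. -/
def posHalf (e : ι → V) (i : ι) : Set V := {v | 0 ≤ ⟪e i, v⟫}

/-- The negative closed half-space bounded by the hyperplane with normal `e i`. -/
def negHalf (e : ι → V) (i : ι) : Set V := {v | ⟪e i, v⟫ ≤ 0}

/-- The separation set of two regions: the (indices of) hyperplanes such that the two
regions lie in opposite closed half-spaces. -/
def sepSet (e : ι → V) (R R' : Set V) : Set ι :=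
  {i | (R ⊆ posHalf e i ∧ R' ⊆ negHalf e i) ∨ (R ⊆ negHalf e i ∧ R' ⊆ posHalf e i)}

/-- The order of the poset of regions `PR(𝒜,B)`. -/
def PRle (e : ι → V) (B R R' : Set V) : Prop := sepSet e B R ⊆ sepSet e B R'

/-- Strict order of the poset of regions. -/
def PRlt (e : ι → V) (B R R' : Set V) : Prop := PRle e B R R' ∧ R ≠ R'

/-- Cover relation in the poset of regions. -/
def PRcover (e : ι → V) (B R R' : Set V) : Prop :=
  PRlt e B R R' ∧ ¬ ∃ U, IsRegion e U ∧ PRlt e B R U ∧ PRlt e B U R'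

/-- A face of the arrangement: an intersection of a nonempty collection of regions. -/
def IsFace (e : ι → V) (F : Set V) : Prop :=
  ∃ Rs : Set (Set V), Rs.Nonempty ∧ (∀ R ∈ Rs, IsRegion e R) ∧ F = ⋂₀ Rs

/-- `[m, M]` is the facial interval of the face `F` in the poset of regions:
the regions containing `F` are exactly those between `m` and `M`. -/
def IsFacialInterval (e : ι → V) (B F m M : Set V) : Prop :=
  IsRegion e m ∧ IsRegion e M ∧
    ∀ R, IsRegion e R → (F ⊆ R ↔ (PRle e B m R ∧ PRle e B R M))

/-- The facial weak order `FW(𝒜,B)`: `F ≤ G` iff `m_F ≤ m_G` and `M_F ≤ M_G`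
in the poset of regions. -/
def FWle (e : ι → V) (B F G : Set V) : Prop :=
  ∃ mF MF mG MG, IsFacialInterval e B F mF MF ∧ IsFacialInterval e B G mG MG ∧
    PRle e B mF mG ∧ PRle e B MF MG

/-- Strict facial weak order. -/
def FWlt (e : ι → V) (B F G : Set V) : Prop := FWle e B F G ∧ F ≠ G

/-- Cover relation in the facial weak order. -/
def FWcover (e : ι → V) (B F G : Set V) : Prop :=
  FWlt e B F G ∧ ¬ ∃ X, IsFace e X ∧ FWlt e B F X ∧ FWlt e B X G

/-- Two faces have the same maximal region `M` of their facial intervals. -/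
def SameMax (e : ι → V) (B F G : Set V) : Prop :=
  ∃ m m' M, IsFacialInterval e B F m M ∧ IsFacialInterval e B G m' M

/-- Two faces have the same minimal region `m` of their facial intervals. -/
def SameMin (e : ι → V) (B F G : Set V) : Prop :=
  ∃ m M M', IsFacialInterval e B F m M ∧ IsFacialInterval e B G m M'

/-- The dimension of a face: the dimension of its linear span. -/
noncomputable def fdim (F : Set V) : ℕ := Module.finrank ℝ (Submodule.span ℝ F)

open Classical in
/-- The covector (sign vector) of a face: the sign of `⟪e i, x⟫` for `x` in the
relative interior of the face. -/
noncomputable def covec (e : ι → V) (F : Set V) (i : ι) : SignType :=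
  if ∀ x ∈ intrinsicInterior ℝ F, 0 < ⟪e i, x⟫ then 1
  else if ∀ x ∈ intrinsicInterior ℝ F, ⟪e i, x⟫ < 0 then -1
  else 0

/-- Composition of sign vectors. -/
def scomp (f g : ι → SignType) (i : ι) : SignType := if f i ≠ 0 then f i else g i

/-- The set of roots of the arrangement: the chosen normals and their opposites. -/
def roots (e : ι → V) : Set V := Set.range e ∪ Set.range (fun i => -(e i))

/-- The root inversion set of a face. -/
def rootInv (e : ι → V) (F : Set V) : Set V :=
  {v ∈ roots e | ∃ x ∈ intrinsicInterior ℝ F, ⟪x, v⟫ ≤ 0}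

/-- `H i` is a wall of the region `R`. -/
noncomputable def IsWall (e : ι → V) (R : Set V) (i : ι) : Prop :=
  fdim ({v : V | ⟪e i, v⟫ = 0} ∩ R) = Module.finrank ℝ V - 1

/-- A region is simplicial when the normal vectors of its walls are linearly independent. -/
def IsSimplicialRegion (e : ι → V) (R : Set V) : Prop :=
  LinearIndependent ℝ (fun i : {i : ι // IsWall e R i} => e i.1)

/-- The arrangement is simplicial when all its regions are. -/
def IsSimplicial (e : ι → V) : Prop := ∀ R, IsRegion e R → IsSimplicialRegion e R

/-- The arrangement is essential when the intersection of all its hyperplanes is `{0}`. -/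
def IsEssential (e : ι → V) : Prop := (⋂ i, {v : V | ⟪e i, v⟫ = 0}) = ({0} : Set V)

/-- The poset of regions is a lattice: any two regions have a join and a meet. -/
def PRIsLattice (e : ι → V) (B : Set V) : Prop :=
  ∀ R R', IsRegion e R → IsRegion e R' →
    (∃ J, IsRegion e J ∧ PRle e B R J ∧ PRle e B R' J ∧
      ∀ U, IsRegion e U → PRle e B R U → PRle e B R' U → PRle e B J U) ∧
    (∃ M, IsRegion e M ∧ PRle e B M R ∧ PRle e B M R' ∧
      ∀ U, IsRegion e U → PRle e B U R → PRle e B U R' → PRle e B U M)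

/-- The closed face of the arrangement whose relative interior contains `x`: the vectors `v`
such that every nonzero sign of `v` agrees with the corresponding sign of `x`. -/
def faceOf (e : ι → V) (x : V) : Set V :=
  {v | ∀ i, (0 < ⟪e i, v⟫ → 0 < ⟪e i, x⟫) ∧ (⟪e i, v⟫ < 0 → ⟪e i, x⟫ < 0)}

/-- The intersection of the hyperplanes containing `x`. -/
def zeroSpace (e : ι → V) (x : V) : Submodule ℝ V where
  carrier := {v | ∀ i, ⟪e i, x⟫ = 0 → ⟪e i, v⟫ = 0}
  add_mem' ha hb i hi := by simp [inner_add_right, ha i hi, hb i hi]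
  zero_mem' i _ := by simp
  smul_mem' c v hv i hi := by simp [inner_smul_right, hv i hi]

/-- The facial weak order on vectors, read off from their signs. -/
def SignLE (e : ι → V) (x y : V) : Prop :=
  ∀ i, (⟪e i, x⟫ < 0 → ⟪e i, y⟫ < 0) ∧ (⟪e i, x⟫ ≤ 0 → ⟪e i, y⟫ ≤ 0)

omit [FiniteDimensional ℝ V] [Fintype ι] in
theorem mem_zeroSpace {e : ι → V} {x v : V} :
    v ∈ zeroSpace e x ↔ ∀ i, ⟪e i, x⟫ = 0 → ⟪e i, v⟫ = 0 := Iff.rfl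

omit [FiniteDimensional ℝ V] [Fintype ι] in
theorem mem_faceOf {e : ι → V} {x v : V} : v ∈ faceOf e x ↔
    ∀ i, (0 < ⟪e i, v⟫ → 0 < ⟪e i, x⟫) ∧ (⟪e i, v⟫ < 0 → ⟪e i, x⟫ < 0) := Iff.rfl

omit [FiniteDimensional ℝ V] [Fintype ι] in
theorem self_mem_faceOf (e : ι → V) (x : V) : x ∈ faceOf e x := fun _ => ⟨id, id⟩

omit [FiniteDimensional ℝ V] [Fintype ι] in
theorem faceOf_subset {e : ι → V} {x y : V} : faceOf e x ⊆ faceOf e y ↔ x ∈ faceOf e y :=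
  ⟨fun h => h (self_mem_faceOf e x), fun h _ hv i =>
    ⟨fun hi => (h i).1 ((hv i).1 hi), fun hi => (h i).2 ((hv i).2 hi)⟩⟩

omit [FiniteDimensional ℝ V] [Fintype ι] in
theorem faceOf_eq {e : ι → V} {x y : V} :
    faceOf e x = faceOf e y ↔ x ∈ faceOf e y ∧ y ∈ faceOf e x := by
  rw [Set.Subset.antisymm_iff, faceOf_subset, faceOf_subset]

omit [FiniteDimensional ℝ V] [Fintype ι] in
theorem zeroSpace_mono {e : ι → V} {x y : V} (h : x ∈ faceOf e y) :
    zeroSpace e x ≤ zeroSpace e y := fun v hv i hi => hv i (by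
  rcases lt_trichotomy ⟪e i, x⟫ 0 with hx | hx | hx
  · exact absurd hi ((h i).2 hx).ne
  · exact hx
  · exact absurd hi ((h i).1 hx).ne')

omit [FiniteDimensional ℝ V] [Fintype ι] in
theorem mem_faceOf_of_zeroSpace_le {e : ι → V} {x y : V} (h : x ∈ faceOf e y)
    (hz : zeroSpace e y ≤ zeroSpace e x) : y ∈ faceOf e x := by
  have hy : y ∈ zeroSpace e x := hz fun i hi => hi
  intro i
  have := h i
  have := hy i
  grind

omit [FiniteDimensional ℝ V] in
theorem exists_pos_perturbation (e : ι → V) (x v : V) :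
    ∃ ε : ℝ, 0 < ε ∧ ∀ i, (0 < ⟪e i, x⟫ → 0 < ⟪e i, x + ε • v⟫) ∧
      (⟪e i, x⟫ < 0 → ⟪e i, x + ε • v⟫ < 0) := by
  have key : ∀ᶠ ε in nhdsWithin (0 : ℝ) (Set.Ioi 0), ∀ i,
      (0 < ⟪e i, x⟫ → 0 < ⟪e i, x + ε • v⟫) ∧ (⟪e i, x⟫ < 0 → ⟪e i, x + ε • v⟫ < 0) := by
    refine Filter.Eventually.filter_mono nhdsWithin_le_nhds ?_
    rw [Filter.eventually_all]
    intro i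
    have hc : ContinuousAt (fun ε : ℝ => ⟪e i, x + ε • v⟫) 0 := by fun_prop
    have h0 : ⟪e i, x + (0 : ℝ) • v⟫ = ⟪e i, x⟫ := by simp
    refine Filter.Eventually.and ?_ ?_
    · by_cases hx : 0 < ⟪e i, x⟫
      · filter_upwards [hc.eventually_const_lt (by simpa using hx)] with ε h _ using h
      · simp [hx]
    · by_cases hx : ⟪e i, x⟫ < 0
      · filter_upwards [hc.eventually_lt_const (by simpa using hx)] with ε h _ using h
      · simp [hx]
  obtain ⟨ε, h, hε⟩ := (key.and self_mem_nhdsWithin).exists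
  exact ⟨ε, hε, h⟩

omit [FiniteDimensional ℝ V] in
/-- Composition of sign vectors, realised by a perturbation of `x` in the direction `v`. -/
theorem exists_composition (e : ι → V) (x v : V) :
    ∃ p, ∀ i, (0 < ⟪e i, p⟫ ↔ 0 < ⟪e i, x⟫ ∨ ⟪e i, x⟫ = 0 ∧ 0 < ⟪e i, v⟫) ∧
      (⟪e i, p⟫ < 0 ↔ ⟪e i, x⟫ < 0 ∨ ⟪e i, x⟫ = 0 ∧ ⟪e i, v⟫ < 0) := by
  obtain ⟨ε, hε, h⟩ := exists_pos_perturbation e x v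
  refine ⟨x + ε • v, fun i => ?_⟩
  rcases lt_trichotomy ⟪e i, x⟫ 0 with hx | hx | hx
  · have := (h i).2 hx
    grind
  · simp [hx, inner_add_right, inner_smul_right, hε, mul_neg_iff, hε.not_gt]
  · have := (h i).1 hx
    grind

omit [FiniteDimensional ℝ V] in
theorem span_faceOf (e : ι → V) (x : V) : Submodule.span ℝ (faceOf e x) = zeroSpace e x := by
  apply le_antisymm
  · rw [Submodule.span_le]
    intro v hv i hi
    have := hv i
    grind
  · intro v hv
    obtain ⟨ε, hε, h⟩ := exists_pos_perturbation e x v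
    have hmem : x + ε • v ∈ faceOf e x := fun i => by
      rcases lt_trichotomy ⟪e i, x⟫ 0 with hx | hx | hx
      · have := (h i).2 hx
        grind
      · simp [hx, inner_add_right, inner_smul_right, hv i hx]
      · have := (h i).1 hx
        grind
    have hv' : v = ε⁻¹ • ((x + ε • v) - x) := by
      rw [add_sub_cancel_left, smul_smul, inv_mul_cancel₀ hε.ne', one_smul]
    rw [hv']
    exact Submodule.smul_mem _ _ (Submodule.sub_mem _ (Submodule.subset_span hmem)
      (Submodule.subset_span (self_mem_faceOf e x)))

omit [FiniteDimensional ℝ V] in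
theorem fdim_faceOf (e : ι → V) (x : V) :
    fdim (faceOf e x) = Module.finrank ℝ (zeroSpace e x) := by
  rw [fdim, span_faceOf]

/-- Consecutive faces in the face poset differ by one in dimension. -/
theorem finrank_zeroSpace_of_forall_between {e : ι → V} {x y : V} (hxy : x ∈ faceOf e y)
    (hne : y ∉ faceOf e x)
    (hb : ∀ p, x ∈ faceOf e p → p ∈ faceOf e y → p ∈ faceOf e x ∨ y ∈ faceOf e p) :
    Module.finrank ℝ (zeroSpace e y) = Module.finrank ℝ (zeroSpace e x) + 1 := by
  have hyx : y ∉ zeroSpace e x := fun h => hne fun i => by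
    have := hxy i
    have := h i
    grind
  have hyy : y ∈ zeroSpace e y := fun i hi => hi
  have hle : zeroSpace e y ≤ zeroSpace e x ⊔ Submodule.span ℝ {y} := by
    intro z hz
    by_contra hzn
    have hzx : z ∉ zeroSpace e x := fun h => hzn (Submodule.mem_sup_left h)
    rw [mem_zeroSpace] at hzx
    push Not at hzx
    obtain ⟨i₀, hi₀, hzi₀⟩ := hzx
    classical
    obtain ⟨j, hj, hmin⟩ := Finset.exists_min_image
      (Finset.univ.filter fun i => ⟪e i, x⟫ = 0 ∧ ⟪e i, z⟫ ≠ 0)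
      (fun i => |⟪e i, y⟫ / ⟪e i, z⟫|) ⟨i₀, by simp [hi₀, hzi₀]⟩
    simp only [Finset.mem_filter, Finset.mem_univ, true_and] at hj hmin
    obtain ⟨hjx, hjz⟩ := hj
    have hjy : ⟪e j, y⟫ ≠ 0 := fun h => hjz (hz j h)
    set t : ℝ := -(⟪e j, y⟫ / ⟪e j, z⟫) with ht
    have ht0 : t ≠ 0 := neg_ne_zero.2 (div_ne_zero hjy hjz)
    have hwj : ⟪e j, y + t • z⟫ = 0 := by
      rw [inner_add_right, inner_smul_right, ht]
      field_simp
      ring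
    have hw : ∀ i, ⟪e i, x⟫ = 0 → (0 < ⟪e i, y + t • z⟫ → 0 < ⟪e i, y⟫) ∧
        (⟪e i, y + t • z⟫ < 0 → ⟪e i, y⟫ < 0) := by
      intro i hi
      rw [inner_add_right, inner_smul_right]
      by_cases hzi : ⟪e i, z⟫ = 0
      · simp [hzi]
      · have h1 := hmin i ⟨hi, hzi⟩
        rw [← abs_neg, ← ht, abs_div, le_div_iff₀ (abs_pos.2 hzi), ← abs_mul] at h1
        have hyi : ⟪e i, y⟫ ≠ 0 := fun h => hzi (hz i h)
        have h2 := (abs_le.1 h1)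
        rcases hyi.lt_or_gt with h | h
        · rw [abs_of_neg h] at h2
          exact ⟨fun _ => by linarith, fun _ => h⟩
        · rw [abs_of_pos h] at h2
          exact ⟨fun _ => h, fun _ => by linarith⟩
    obtain ⟨p, hp⟩ := exists_composition e x (y + t • z)
    rcases hb p (fun i => by have := hp i; grind)
        (fun i => by have := hp i; have := hw i; have := hxy i; grind) with h | h
    · have hmem : y + t • z ∈ zeroSpace e x := fun i hi => by
        have := hp i
        have := h i
        grind
      apply hzn
      have hz' : z = t⁻¹ • (y + t • z) + (-t⁻¹) • y := by
        rw [smul_add, smul_smul, inv_mul_cancel₀ ht0, one_smul, neg_smul]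
        abel
      rw [hz']
      exact Submodule.add_mem _ (Submodule.mem_sup_left (Submodule.smul_mem _ _ hmem))
        (Submodule.mem_sup_right (Submodule.smul_mem _ _ (Submodule.mem_span_singleton_self y)))
    · have := hp j
      have := h j
      grind
  have heq : zeroSpace e y = zeroSpace e x ⊔ Submodule.span ℝ {y} :=
    le_antisymm hle (sup_le (zeroSpace_mono hxy)
      ((Submodule.span_singleton_le_iff_mem _ _).2 hyy))
  rw [heq, Submodule.finrank_sup_span_singleton hyx]

omit [Fintype ι] in
theorem forall_between_of_finrank_zeroSpace {e : ι → V} {x y p : V}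
    (hdim : Module.finrank ℝ (zeroSpace e y) = Module.finrank ℝ (zeroSpace e x) + 1)
    (hxp : x ∈ faceOf e p) (hpy : p ∈ faceOf e y) : p ∈ faceOf e x ∨ y ∈ faceOf e p := by
  by_contra! h
  have h1 : zeroSpace e x < zeroSpace e p :=
    lt_of_le_not_ge (zeroSpace_mono hxp) fun hz => h.1 (mem_faceOf_of_zeroSpace_le hxp hz)
  have h2 : zeroSpace e p < zeroSpace e y :=
    lt_of_le_not_ge (zeroSpace_mono hpy) fun hz => h.2 (mem_faceOf_of_zeroSpace_le hpy hz)
  have := Submodule.finrank_lt_finrank_of_lt h1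
  have := Submodule.finrank_lt_finrank_of_lt h2
  omega

/-- The cover relations of the facial weak order in terms of signs. -/
theorem signLE_cover_iff (e : ι → V) (x y : V) :
    ((SignLE e x y ∧ faceOf e x ≠ faceOf e y) ∧
      ∀ p, SignLE e x p → SignLE e p y → faceOf e x = faceOf e p ∨ faceOf e p = faceOf e y) ↔
    ((fdim (faceOf e x) = fdim (faceOf e y) + 1 ∨ fdim (faceOf e y) = fdim (faceOf e x) + 1) ∧
      ((x ∈ faceOf e y ∧ ∀ i, ⟪e i, x⟫ ≤ 0 ↔ ⟪e i, y⟫ ≤ 0) ∨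
        (y ∈ faceOf e x ∧ ∀ i, ⟪e i, x⟫ < 0 ↔ ⟪e i, y⟫ < 0))) := by
  simp only [fdim_faceOf, ne_eq, faceOf_eq]
  constructor
  · rintro ⟨⟨hle, hne⟩, hb⟩
    obtain ⟨p, hp⟩ := exists_composition e x y
    obtain ⟨q, hq⟩ := exists_composition e y x
    rcases hb p (fun i => by have := hp i; have := hle i; grind)
        (fun i => by have := hp i; have := hle i; grind) with hxp | hpy
    · rcases hb q (fun i => by have := hq i; have := hle i; grind)
          (fun i => by have := hq i; have := hle i; grind) with hxq | hqy
      · have hyx : y ∈ faceOf e x := fun i => by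
          have := hq i
          have := hxq.2 i
          grind
        have hm : ∀ i, ⟪e i, x⟫ < 0 ↔ ⟪e i, y⟫ < 0 := fun i => by
          have := hyx i
          have := hle i
          grind
        have hxy : x ∉ faceOf e y := fun h => hne ⟨h, hyx⟩
        refine ⟨Or.inl (finrank_zeroSpace_of_forall_between hyx hxy fun r hyr hrx => ?_),
          Or.inr ⟨hyx, hm⟩⟩
        rcases hb r (fun i => by have := hyr i; have := hrx i; have := hm i; grind)
          (fun i => by have := hyr i; have := hrx i; have := hm i; grind) with h | h
        · exact Or.inr h.1
        · exact Or.inl h.1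
      · exfalso
        have hzero : ∀ i, ⟪e i, x⟫ = 0 ↔ ⟪e i, y⟫ = 0 := fun i => by
          have := hp i
          have := hq i
          have := hxp.2 i
          have := hqy.1 i
          grind
        obtain ⟨i, hxi, hyi⟩ : ∃ i, 0 < ⟪e i, x⟫ ∧ ⟪e i, y⟫ < 0 := by
          by_contra! h
          exact hne ⟨fun i => by have := h i; have := hle i; have := hzero i; grind,
            fun i => by have := h i; have := hle i; have := hzero i; grind⟩
        set r : V := (-⟪e i, y⟫) • x + ⟪e i, x⟫ • y with hr
        have hri : ∀ k, ⟪e k, r⟫ = -⟪e i, y⟫ * ⟪e k, x⟫ + ⟪e i, x⟫ * ⟪e k, y⟫ := fun k => by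
          rw [hr, inner_add_right, inner_smul_right, inner_smul_right]
        have hr0 : ⟪e i, r⟫ = 0 := by rw [hri]; ring
        have hbetween : ∀ k, (⟪e k, x⟫ < 0 → ⟪e k, r⟫ < 0) ∧ (⟪e k, r⟫ < 0 → ⟪e k, y⟫ < 0) ∧
            (⟪e k, x⟫ ≤ 0 → ⟪e k, r⟫ ≤ 0) ∧ (⟪e k, r⟫ ≤ 0 → ⟪e k, y⟫ ≤ 0) := fun k => by
          have hk := hle k
          have hk0 := hzero k
          rw [hri]
          refine ⟨fun h => ?_, fun h => ?_, fun h => ?_, fun h => ?_⟩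
          · nlinarith [hk.1 h]
          · by_contra! hy
            nlinarith [not_lt.1 (mt hk.1 hy.not_gt)]
          · nlinarith [hk.2 h]
          · by_contra! hy
            nlinarith [not_le.1 (mt hk.2 hy.not_ge)]
        rcases hb r (fun k => ⟨(hbetween k).1, (hbetween k).2.2.1⟩)
            (fun k => ⟨(hbetween k).2.1, (hbetween k).2.2.2⟩) with h | h
        · have := h.1 i
          grind
        · have := h.2 i
          grind
    · have hxy : x ∈ faceOf e y := fun i => by
        have := hp i
        have := hpy.1 i
        grind
      have hm : ∀ i, ⟪e i, x⟫ ≤ 0 ↔ ⟪e i, y⟫ ≤ 0 := fun i => by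
        have := hxy i
        have := hle i
        grind
      have hyx : y ∉ faceOf e x := fun h => hne ⟨hxy, h⟩
      refine ⟨Or.inr (finrank_zeroSpace_of_forall_between hxy hyx fun r hxr hry => ?_),
        Or.inl ⟨hxy, hm⟩⟩
      rcases hb r (fun i => by have := hxr i; have := hry i; have := hm i; grind)
        (fun i => by have := hxr i; have := hry i; have := hm i; grind) with h | h
      · exact Or.inl h.2
      · exact Or.inr h.2
  · rintro ⟨hdim, ⟨hxy, hm⟩ | ⟨hyx, hm⟩⟩
    · have hd := Submodule.finrank_mono (zeroSpace_mono hxy)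
      refine ⟨⟨fun i => by have := hxy i; have := hm i; grind, fun h => ?_⟩, fun p h1 h2 => ?_⟩
      · have := Submodule.finrank_mono (zeroSpace_mono h.2)
        omega
      · have hxp : x ∈ faceOf e p := fun i => by
          have := hxy i; have := h1 i; have := h2 i; have := hm i; grind
        have hpy : p ∈ faceOf e y := fun i => by
          have := hxy i; have := h1 i; have := h2 i; have := hm i; grind
        exact (forall_between_of_finrank_zeroSpace (by omega) hxp hpy).imp
          (fun h => ⟨hxp, h⟩) fun h => ⟨hpy, h⟩
    · have hd := Submodule.finrank_mono (zeroSpace_mono hyx)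
      refine ⟨⟨fun i => by have := hyx i; have := hm i; grind, fun h => ?_⟩, fun p h1 h2 => ?_⟩
      · have := Submodule.finrank_mono (zeroSpace_mono h.1)
        omega
      · have hpx : p ∈ faceOf e x := fun i => by
          have := hyx i; have := h1 i; have := h2 i; have := hm i; grind
        have hyp : y ∈ faceOf e p := fun i => by
          have := hyx i; have := h1 i; have := h2 i; have := hm i; grind
        exact (forall_between_of_finrank_zeroSpace (by omega) hyp hpx).symm.imp
          (fun h => ⟨h, hpx⟩) fun h => ⟨h, hyp⟩

omit [FiniteDimensional ℝ V] [Fintype ι] in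
theorem connectedComponentIn_arrComplement {e : ι → V} {x : V} (hx : x ∈ arrComplement e) :
    connectedComponentIn (arrComplement e) x = {v | ∀ i, 0 < ⟪e i, x⟫ * ⟪e i, v⟫} := by
  apply Set.Subset.antisymm
  · intro v hv i
    by_contra! hi
    have hcont : ContinuousOn (fun w : V => ⟪e i, x⟫ * ⟪e i, w⟫)
        (connectedComponentIn (arrComplement e) x) := by fun_prop
    obtain ⟨w, hw, hw0⟩ := isPreconnected_connectedComponentIn.intermediate_value hv
      (mem_connectedComponentIn hx) hcont ⟨hi, mul_self_nonneg _⟩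
    exact mul_ne_zero (hx i) (connectedComponentIn_subset _ _ hw i) hw0
  · refine IsPreconnected.subset_connectedComponentIn (Convex.isPreconnected ?_)
      (fun i => mul_self_pos.2 (hx i)) fun v hv i hi => ?_
    · intro u hu v hv a b ha hb hab i
      rw [inner_add_right, inner_smul_right, inner_smul_right]
      have h1 := hu i
      have h2 := hv i
      rcases ha.eq_or_lt with rfl | ha
      · rw [zero_add] at hab
        simpa [hab] using h2
      · nlinarith [mul_pos ha h1, mul_nonneg hb h2.le]
    · have := hv i
      simp [hi] at this

omit [FiniteDimensional ℝ V] [Fintype ι] in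
theorem closure_connectedComponentIn_arrComplement {e : ι → V} {x : V}
    (hx : x ∈ arrComplement e) :
    closure (connectedComponentIn (arrComplement e) x) = faceOf e x := by
  rw [connectedComponentIn_arrComplement hx]
  apply Set.Subset.antisymm
  · have hclosed : IsClosed {v : V | ∀ i, 0 ≤ ⟪e i, x⟫ * ⟪e i, v⟫} := by
      simp only [Set.ofPred_forall]
      exact isClosed_iInter fun i => isClosed_le (by fun_prop) (by fun_prop)
    intro v hv i
    have h := closure_minimal (fun v hv i => (hv i).le) hclosed hv i
    have := hx i
    constructor <;> intro hi
    · exact lt_of_le_of_ne (nonneg_of_mul_nonneg_left h hi) this.symm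
    · exact lt_of_le_of_ne (nonpos_of_mul_nonneg_left h hi) this
  · intro v hv
    have hlim : Filter.Tendsto (fun ε : ℝ => v + ε • x) (nhdsWithin 0 (Set.Ioi 0))
        (nhds v) := by
      have : ContinuousAt (fun ε : ℝ => v + ε • x) 0 := by fun_prop
      simpa using this.tendsto.mono_left nhdsWithin_le_nhds
    refine mem_closure_of_tendsto hlim ?_
    filter_upwards [self_mem_nhdsWithin] with ε (hε : 0 < ε) i
    rw [inner_add_right, inner_smul_right, mul_add]
    have h1 : 0 < ⟪e i, x⟫ * (ε * ⟪e i, x⟫) := by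
      rw [mul_left_comm]
      exact mul_pos hε (mul_self_pos.2 (hx i))
    have h2 : 0 ≤ ⟪e i, x⟫ * ⟪e i, v⟫ := by
      rcases lt_trichotomy ⟪e i, v⟫ 0 with h | h | h
      · exact (mul_pos_of_neg_of_neg ((hv i).2 h) h).le
      · simp [h]
      · exact (mul_pos ((hv i).1 h) h).le
    linarith

omit [FiniteDimensional ℝ V] [Fintype ι] in
theorem isRegion_iff {e : ι → V} {R : Set V} :
    IsRegion e R ↔ ∃ x ∈ arrComplement e, R = faceOf e x :=
  exists_congr fun x => and_congr_right fun hx => by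
    rw [closure_connectedComponentIn_arrComplement hx]

omit [FiniteDimensional ℝ V] [Fintype ι] in
/-- The base region is the face of a vector on which all the chosen normals are positive. -/
theorem exists_pos_of_isRegion {e : ι → V} {B : Set V} (hB : IsRegion e B)
    (hBpos : ∀ i, B ⊆ posHalf e i) : ∃ b, (∀ i, 0 < ⟪e i, b⟫) ∧ B = faceOf e b := by
  obtain ⟨b, hb, rfl⟩ := isRegion_iff.1 hB
  exact ⟨b, fun i => lt_of_le_of_ne (hBpos i (self_mem_faceOf e b)) (hb i).symm, rfl⟩

omit [FiniteDimensional ℝ V] [Fintype ι] in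
theorem sepSet_faceOf {e : ι → V} {b r : V} (hb : ∀ i, 0 < ⟪e i, b⟫)
    (hr : r ∈ arrComplement e) : sepSet e (faceOf e b) (faceOf e r) = {i | ⟪e i, r⟫ < 0} := by
  ext i
  constructor
  · rintro (⟨-, h⟩ | ⟨h, -⟩)
    · exact lt_of_le_of_ne (h (self_mem_faceOf e r)) (hr i)
    · exact absurd (h (self_mem_faceOf e b)) (hb i).not_ge
  · intro h
    refine Or.inl ⟨fun v hv => ?_, fun v hv => ?_⟩
    · exact not_lt.1 fun hi => (hb i).not_gt ((hv i).2 hi)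
    · exact not_lt.1 fun hi => lt_asymm h ((hv i).1 hi)

omit [FiniteDimensional ℝ V] [Fintype ι] in
theorem PRle_faceOf {e : ι → V} {b r s : V} (hb : ∀ i, 0 < ⟪e i, b⟫)
    (hr : r ∈ arrComplement e) (hs : s ∈ arrComplement e) :
    PRle e (faceOf e b) (faceOf e r) (faceOf e s) ↔ ∀ i, ⟪e i, r⟫ < 0 → ⟪e i, s⟫ < 0 := by
  rw [PRle, sepSet_faceOf hb hr, sepSet_faceOf hb hs]
  rfl

omit [FiniteDimensional ℝ V] in
theorem exists_min_region {e : ι → V} {b : V} (hb : ∀ i, 0 < ⟪e i, b⟫) (x : V) :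
    ∃ r ∈ arrComplement e, ∀ i, ⟪e i, r⟫ < 0 ↔ ⟪e i, x⟫ < 0 := by
  obtain ⟨r, hr⟩ := exists_composition e x b
  exact ⟨r, fun i => by have := hr i; have := hb i; grind,
    fun i => by have := hr i; have := hb i; grind⟩

omit [FiniteDimensional ℝ V] in
theorem exists_max_region {e : ι → V} {b : V} (hb : ∀ i, 0 < ⟪e i, b⟫) (x : V) :
    ∃ s ∈ arrComplement e, ∀ i, ⟪e i, s⟫ < 0 ↔ ⟪e i, x⟫ ≤ 0 := by
  obtain ⟨s, hs⟩ := exists_composition e x (-b)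
  simp only [inner_neg_right] at hs
  exact ⟨s, fun i => by have := hs i; have := hb i; grind,
    fun i => by have := hs i; have := hb i; grind⟩

omit [FiniteDimensional ℝ V] [Fintype ι] in
theorem isFacialInterval_faceOf {e : ι → V} {b x r s : V} (hb : ∀ i, 0 < ⟪e i, b⟫)
    (hr : r ∈ arrComplement e) (hrx : ∀ i, ⟪e i, r⟫ < 0 ↔ ⟪e i, x⟫ < 0)
    (hs : s ∈ arrComplement e) (hsx : ∀ i, ⟪e i, s⟫ < 0 ↔ ⟪e i, x⟫ ≤ 0) :
    IsFacialInterval e (faceOf e b) (faceOf e x) (faceOf e r) (faceOf e s) := by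
  refine ⟨isRegion_iff.2 ⟨r, hr, rfl⟩, isRegion_iff.2 ⟨s, hs, rfl⟩, fun R hR => ?_⟩
  obtain ⟨q, hq, rfl⟩ := isRegion_iff.1 hR
  rw [PRle_faceOf hb hr hq, PRle_faceOf hb hq hs, faceOf_subset, ← forall_and]
  refine forall_congr' fun i => ?_
  have := hrx i
  have := hsx i
  have := hq i
  grind

omit [FiniteDimensional ℝ V] in
theorem eq_of_isFacialInterval_faceOf {e : ι → V} {b x : V} (hb : ∀ i, 0 < ⟪e i, b⟫)
    {m M : Set V} (h : IsFacialInterval e (faceOf e b) (faceOf e x) m M) :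
    ∃ r ∈ arrComplement e, ∃ s ∈ arrComplement e, m = faceOf e r ∧ M = faceOf e s ∧
      (∀ i, ⟪e i, r⟫ < 0 ↔ ⟪e i, x⟫ < 0) ∧ ∀ i, ⟪e i, s⟫ < 0 ↔ ⟪e i, x⟫ ≤ 0 := by
  obtain ⟨hm, hM, hmM⟩ := h
  obtain ⟨r, hr, rfl⟩ := isRegion_iff.1 hm
  obtain ⟨s, hs, rfl⟩ := isRegion_iff.1 hM
  obtain ⟨r', hr', hrx⟩ := exists_min_region hb x
  obtain ⟨s', hs', hsx⟩ := exists_max_region hb x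
  have key : ∀ q ∈ arrComplement e, ((∀ i, ⟪e i, r'⟫ < 0 → ⟪e i, q⟫ < 0) ∧
      ∀ i, ⟪e i, q⟫ < 0 → ⟪e i, s'⟫ < 0) ↔ ((∀ i, ⟪e i, r⟫ < 0 → ⟪e i, q⟫ < 0) ∧
      ∀ i, ⟪e i, q⟫ < 0 → ⟪e i, s⟫ < 0) := by
    intro q hq
    have hqR := isRegion_iff.2 ⟨q, hq, rfl⟩
    rw [← PRle_faceOf hb hr' hq, ← PRle_faceOf hb hq hs', ← PRle_faceOf hb hr hq,
      ← PRle_faceOf hb hq hs, ← hmM _ hqR,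
      (isFacialInterval_faceOf hb hr' hrx hs' hsx).2.2 _ hqR]
  have hrs' : ∀ i, ⟪e i, r'⟫ < 0 → ⟪e i, s'⟫ < 0 := fun i hi =>
    (hsx i).2 ((hrx i).1 hi).le
  have h1 := (key r' hr').1 ⟨fun _ => id, hrs'⟩
  have h2 := (key s' hs').1 ⟨hrs', fun _ => id⟩
  have hrs : ∀ i, ⟪e i, r⟫ < 0 → ⟪e i, s⟫ < 0 := fun i hi => h1.2 i (h1.1 i hi)
  have h3 := (key r hr).2 ⟨fun _ => id, hrs⟩
  have h4 := (key s hs).2 ⟨hrs, fun _ => id⟩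
  exact ⟨r, hr, s, hs, rfl, rfl,
    fun i => ⟨fun hi => (hrx i).1 (h1.1 i hi), fun hi => h3.1 i ((hrx i).2 hi)⟩,
    fun i => ⟨fun hi => (hsx i).1 (h4.2 i hi), fun hi => h2.2 i ((hsx i).2 hi)⟩⟩

omit [FiniteDimensional ℝ V] in
theorem FWle_faceOf {e : ι → V} {b x y : V} (hb : ∀ i, 0 < ⟪e i, b⟫) :
    FWle e (faceOf e b) (faceOf e x) (faceOf e y) ↔ SignLE e x y := by
  constructor
  · rintro ⟨_, _, _, _, hx, hy, hm, hM⟩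
    obtain ⟨r, hr, s, hs, rfl, rfl, hrx, hsx⟩ := eq_of_isFacialInterval_faceOf hb hx
    obtain ⟨r', hr', s', hs', rfl, rfl, hrx', hsx'⟩ := eq_of_isFacialInterval_faceOf hb hy
    rw [PRle_faceOf hb hr hr'] at hm
    rw [PRle_faceOf hb hs hs'] at hM
    simp only [hrx, hrx', hsx, hsx'] at hm hM
    exact fun i => ⟨hm i, hM i⟩
  · intro h
    obtain ⟨r, hr, hrx⟩ := exists_min_region hb x
    obtain ⟨s, hs, hsx⟩ := exists_max_region hb x
    obtain ⟨r', hr', hrx'⟩ := exists_min_region hb y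
    obtain ⟨s', hs', hsx'⟩ := exists_max_region hb y
    refine ⟨_, _, _, _, isFacialInterval_faceOf hb hr hrx hs hsx,
      isFacialInterval_faceOf hb hr' hrx' hs' hsx', ?_, ?_⟩
    · rw [PRle_faceOf hb hr hr']
      simp only [hrx, hrx']
      exact fun i => (h i).1
    · rw [PRle_faceOf hb hs hs']
      simp only [hsx, hsx']
      exact fun i => (h i).2

omit [FiniteDimensional ℝ V] [Fintype ι] in
theorem faceOf_eq_of_mem_arrComplement {e : ι → V} {r s : V} (hr : r ∈ arrComplement e)
    (hs : s ∈ arrComplement e) :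
    faceOf e r = faceOf e s ↔ ∀ i, ⟪e i, r⟫ < 0 ↔ ⟪e i, s⟫ < 0 := by
  rw [faceOf_eq, mem_faceOf, mem_faceOf, ← forall_and]
  refine forall_congr' fun i => ?_
  have := hr i
  have := hs i
  grind

omit [FiniteDimensional ℝ V] in
theorem isFace_faceOf {e : ι → V} {b : V} (hb : ∀ i, 0 < ⟪e i, b⟫) (x : V) :
    IsFace e (faceOf e x) := by
  obtain ⟨r, hr, hrx⟩ := exists_min_region hb x
  obtain ⟨s, hs, hsx⟩ := exists_max_region hb x
  refine ⟨{faceOf e r, faceOf e s}, Set.insert_nonempty _ _, ?_, ?_⟩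
  · rintro R (rfl | rfl)
    exacts [isRegion_iff.2 ⟨r, hr, rfl⟩, isRegion_iff.2 ⟨s, hs, rfl⟩]
  · ext v
    rw [Set.sInter_pair, Set.mem_inter_iff, mem_faceOf, mem_faceOf, mem_faceOf, ← forall_and]
    refine forall_congr' fun i => ?_
    have := hrx i
    have := hsx i
    have := hr i
    have := hs i
    grind

omit [FiniteDimensional ℝ V] in
theorem exists_eq_faceOf_of_isFace {e : ι → V} {F : Set V} (hF : IsFace e F) :
    ∃ x, F = faceOf e x := by
  classical
  obtain ⟨Rs, ⟨R₀, hR₀⟩, hRs, rfl⟩ := hF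
  obtain ⟨a₀, ha₀, h₀⟩ := isRegion_iff.1 (hRs R₀ hR₀)
  have hmem : ∀ v, v ∈ ⋂₀ Rs ↔ ∀ a ∈ arrComplement e, faceOf e a ∈ Rs → v ∈ faceOf e a := by
    intro v
    rw [Set.mem_sInter]
    refine ⟨fun h a _ ha => h _ ha, fun h R hR => ?_⟩
    obtain ⟨a, ha, rfl⟩ := isRegion_iff.1 (hRs R hR)
    exact h a ha hR
  -- A vector of `F` lying on as few hyperplanes as possible.
  obtain ⟨x, hx, hmin⟩ := exists_minimalFor_of_wellFoundedLT (fun v => v ∈ ⋂₀ Rs)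
    (fun v => Finset.univ.filter fun i => ⟪e i, v⟫ = 0)
    ⟨0, (hmem 0).2 fun a _ _ i => by simp⟩
  refine ⟨x, Set.Subset.antisymm (fun v hv => ?_) fun v hv => (hmem v).2 fun a ha haR =>
    faceOf_subset.2 ((hmem x).1 hx a ha haR) hv⟩
  have hxa₀ := (hmem x).1 hx a₀ ha₀ (h₀ ▸ hR₀)
  have hva₀ := (hmem v).1 hv a₀ ha₀ (h₀ ▸ hR₀)
  have hxv : x + v ∈ ⋂₀ Rs := (hmem _).2 fun a ha haR i => by
    have h1 := (hmem x).1 hx a ha haR i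
    have h2 := (hmem v).1 hv a ha haR i
    rw [inner_add_right]
    grind
  have hle := hmin hxv (fun i hi => by
    have h1 := hxa₀ i
    have h2 := hva₀ i
    simp only [Finset.mem_filter, Finset.mem_univ, true_and, inner_add_right] at hi ⊢
    grind)
  intro i
  have h1 := hxa₀ i
  have h2 := hva₀ i
  by_cases hi : ⟪e i, x⟫ = 0
  · have h3 := hle (Finset.mem_filter.2 ⟨Finset.mem_univ i, hi⟩)
    simp only [Finset.mem_filter, Finset.mem_univ, true_and, inner_add_right, hi, zero_add] at h3
    simp [h3]
  · grind

/-- `G` covers `F` in the facial weak order iff `|dim F - dim G| = 1` and either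
(`F ⊆ G` and `M_F = M_G`) or (`G ⊆ F` and `m_F = m_G`). -/
theorem stmt4 (e : ι → V) (hne : ∀ i, e i ≠ 0) (B : Set V)
    (hB : IsRegion e B) (hBpos : ∀ i, B ⊆ posHalf e i)
    (F G mF MF mG MG : Set V) (hF : IsFace e F) (hG : IsFace e G)
    (hFI : IsFacialInterval e B F mF MF) (hGI : IsFacialInterval e B G mG MG) :
    FWcover e B F G ↔
      ((fdim F = fdim G + 1 ∨ fdim G = fdim F + 1) ∧
        ((F ⊆ G ∧ MF = MG) ∨ (G ⊆ F ∧ mF = mG))) := by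
  obtain ⟨b, hb, rfl⟩ := exists_pos_of_isRegion hB hBpos
  obtain ⟨x, rfl⟩ := exists_eq_faceOf_of_isFace hF
  obtain ⟨y, rfl⟩ := exists_eq_faceOf_of_isFace hG
  obtain ⟨r, hr, s, hs, rfl, rfl, hrx, hsx⟩ := eq_of_isFacialInterval_faceOf hb hFI
  obtain ⟨r', hr', s', hs', rfl, rfl, hry, hsy⟩ := eq_of_isFacialInterval_faceOf hb hGI
  rw [faceOf_eq_of_mem_arrComplement hr hr', faceOf_eq_of_mem_arrComplement hs hs',
    faceOf_subset, faceOf_subset]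
  simp only [hrx, hsx, hry, hsy]
  rw [← signLE_cover_iff, FWcover, FWlt, FWle_faceOf hb]
  refine and_congr_right fun _ => ⟨fun h p hxp hpy => ?_, fun h => ?_⟩
  · by_contra! hp
    exact h ⟨faceOf e p, isFace_faceOf hb p, ⟨(FWle_faceOf hb).2 hxp, hp.1⟩,
      ⟨(FWle_faceOf hb).2 hpy, hp.2⟩⟩
  · rintro ⟨X, hX, ⟨hxX, hx⟩, ⟨hXy, hy⟩⟩
    obtain ⟨p, rfl⟩ := exists_eq_faceOf_of_isFace hX
    exact (h p ((FWle_faceOf hb).1 hxX) ((FWle_faceOf hb).1 hXy)).elim hx hy
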